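/- arXiv:math/0510201 — 3 statements merged into one kernel-verified Lean document; each statement's English description precedes it below -/
import Mathlib

section
/- Let A be a principal ideal domain with only finitely many maximal ideals (a semi-local PID) and n ≥ 1. Let S ⊆ A[x₁,…,xₙ] be the set of polynomials f = Σ_I a_I x^I whose coefficients a_I generate the unit ideal of A. Then S is a multiplicatively closed set, the localization A(x₁,…,xₙ) := S⁻¹A[x₁,…,xₙ] is again a principal ideal domain with only finitely many maximal ideals, and the natural ring map A → A(x₁,…,xₙ) is faithfully flat. -/
/-!
Statement 5: for a semi-local PID `A`, the set `S` of polynomials in `A[x₁,…,xₙ]` whose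
coefficients generate the unit ideal is multiplicatively closed, the localization
`A(x₁,…,xₙ) = S⁻¹A[x₁,…,xₙ]` is again a semi-local PID, and `A → A(x₁,…,xₙ)` is faithfully
flat.
-/

noncomputable section

/-- The set of polynomials `f = Σ_I a_I x^I` whose coefficients generate the unit ideal. -/
def coeffUnitSet (σ A : Type*) [CommRing A] : Set (MvPolynomial σ A) :=
  {f | Ideal.span (Set.range fun s => MvPolynomial.coeff s f) = ⊤}

theorem coeff_span_le_iff {σ A : Type*} [CommRing A] (f : MvPolynomial σ A) (I : Ideal A) :
    Ideal.span (Set.range fun s => MvPolynomial.coeff s f) ≤ I ↔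
      MvPolynomial.map (Ideal.Quotient.mk I) f = 0 := by
  rw [Ideal.span_le, Set.range_subset_iff, MvPolynomial.ext_iff]
  simp [MvPolynomial.coeff_map, Ideal.Quotient.eq_zero_iff_mem]

theorem mem_coeffUnitSet_iff {σ A : Type*} [CommRing A] (f : MvPolynomial σ A) :
    f ∈ coeffUnitSet σ A ↔
      ∀ m : Ideal A, m.IsMaximal → MvPolynomial.map (Ideal.Quotient.mk m) f ≠ 0 := by
  simp only [← coeff_span_le_iff, ne_eq]
  refine ⟨fun h m hm hle => hm.ne_top (top_le_iff.mp (le_of_eq_of_le h.symm hle)), fun h => ?_⟩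
  by_contra hne
  obtain ⟨m, hm, hle⟩ := Ideal.exists_le_maximal _ hne
  exact h m hm hle

/-- The polynomials whose coefficients generate the unit ideal, as a submonoid. -/
def coeffUnitSubmonoid (σ A : Type*) [CommRing A] : Submonoid (MvPolynomial σ A) where
  carrier := coeffUnitSet σ A
  one_mem' := (mem_coeffUnitSet_iff 1).mpr fun m hm => by simp
  mul_mem' {f g} hf hg := (mem_coeffUnitSet_iff _).mpr fun m hm => by
    rw [map_mul]
    exact mul_ne_zero ((mem_coeffUnitSet_iff f).mp hf m hm) ((mem_coeffUnitSet_iff g).mp hg m hm)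

theorem zero_notMem_coeffUnitSubmonoid (σ A : Type*) [CommRing A] [Nontrivial A] :
    (0 : MvPolynomial σ A) ∉ coeffUnitSubmonoid σ A := fun h => by
  obtain ⟨m, hm⟩ := Ideal.exists_maximal A
  exact (mem_coeffUnitSet_iff 0).mp h m hm (map_zero _)

/-- Over a principal ideal domain, every polynomial is a constant times a polynomial whose
coefficients generate the unit ideal. -/
theorem exists_eq_C_mul_mem_coeffUnitSubmonoid {σ A : Type*} [CommRing A] [IsDomain A]
    [IsPrincipalIdealRing A] (f : MvPolynomial σ A) :
    ∃ c : A, ∃ g ∈ coeffUnitSubmonoid σ A, f = MvPolynomial.C c * g := by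
  by_cases hf : f = 0
  · exact ⟨0, 1, one_mem _, by simp [hf]⟩
  obtain ⟨c, hc⟩ := IsPrincipalIdealRing.principal
    (Ideal.span (Set.range fun s => MvPolynomial.coeff s f))
  rw [Ideal.submodule_span_eq] at hc
  have hdvd : MvPolynomial.C c ∣ f := by
    rw [MvPolynomial.C_dvd_iff_dvd_coeff]
    intro s
    rw [← Ideal.mem_span_singleton, ← hc]
    exact Ideal.subset_span ⟨s, rfl⟩
  obtain ⟨g, rfl⟩ := hdvd
  have hc0 : c ≠ 0 := by
    rintro rfl
    simp at hf
  refine ⟨c, g, ?_, rfl⟩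
  have hspan : Ideal.span {c} * Ideal.span (Set.range fun s => MvPolynomial.coeff s g) =
      Ideal.span {c} * ⊤ := by
    rw [Ideal.mul_top, Ideal.span_mul_span', Set.singleton_mul, ← Set.range_comp, ← hc]
    simp [Function.comp_def, MvPolynomial.coeff_C_mul]
  exact (Ideal.span_singleton_mul_right_inj hc0).mp hspan

theorem map_comap_eq_of_associated {A B : Type*} [CommRing A] [CommRing B] (φ : A →+* B)
    (h : ∀ b, ∃ a, Associated (φ a) b) (I : Ideal B) : (I.comap φ).map φ = I := by
  refine le_antisymm Ideal.map_comap_le fun b hb => ?_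
  obtain ⟨a, ha⟩ := h b
  exact Ideal.mem_of_dvd _ ha.dvd
    (Ideal.mem_map_of_mem φ (Ideal.mem_of_dvd _ ha.symm.dvd hb : φ a ∈ I))

theorem isPrincipalIdealRing_of_associated {A B : Type*} [CommRing A] [CommRing B]
    [IsPrincipalIdealRing A] (φ : A →+* B) (h : ∀ b, ∃ a, Associated (φ a) b) :
    IsPrincipalIdealRing B where
  principal I := by
    obtain ⟨a, ha⟩ := IsPrincipalIdealRing.principal (I.comap φ)
    refine ⟨φ a, ?_⟩
    rw [← map_comap_eq_of_associated φ h I, ha, Ideal.submodule_span_eq, Ideal.map_span,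
      Set.image_singleton, Ideal.submodule_span_eq]

theorem finite_isPrime_of_finite_isMaximal {A : Type*} [CommRing A] [IsDomain A]
    [IsPrincipalIdealRing A] (h : {I : Ideal A | I.IsMaximal}.Finite) :
    {I : Ideal A | I.IsPrime}.Finite := by
  refine (h.insert ⊥).subset fun I (hI : I.IsPrime) => ?_
  by_cases h0 : I = ⊥
  · exact Or.inl h0
  · exact Or.inr (IsPrime.to_maximal_ideal h0)

theorem finite_isMaximal_of_associated {A B : Type*} [CommRing A] [CommRing B] (φ : A →+* B)
    (h : ∀ b, ∃ a, Associated (φ a) b) (hA : {I : Ideal A | I.IsPrime}.Finite) :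
    {I : Ideal B | I.IsMaximal}.Finite := by
  refine Set.Finite.of_finite_image (f := Ideal.comap φ) (hA.subset ?_)
    (Function.LeftInverse.injective (map_comap_eq_of_associated φ h)).injOn
  rintro _ ⟨I, hI : I.IsMaximal, rfl⟩
  exact hI.isPrime.comap φ

/-- The natural map from `A` to the localization of `A[x]` at the polynomials whose coefficients
generate the unit ideal. -/
def toLocalizationCoeffUnit (σ A : Type*) [CommRing A] :
    A →+* Localization (coeffUnitSubmonoid σ A) :=
  (algebraMap (MvPolynomial σ A) (Localization (coeffUnitSubmonoid σ A))).comp MvPolynomial.C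

theorem exists_associated_toLocalizationCoeffUnit {σ A : Type*} [CommRing A] [IsDomain A]
    [IsPrincipalIdealRing A] (b : Localization (coeffUnitSubmonoid σ A)) :
    ∃ a, Associated (toLocalizationCoeffUnit σ A a) b := by
  obtain ⟨f, s, rfl⟩ := IsLocalization.exists_mk'_eq (coeffUnitSubmonoid σ A) b
  obtain ⟨c, g, hg, rfl⟩ := exists_eq_C_mul_mem_coeffUnitSubmonoid f
  refine ⟨c, Associated.trans (y := algebraMap _ _ (MvPolynomial.C c * g)) ?_ ?_⟩
  · rw [map_mul]
    exact associated_mul_unit_right _ _ (IsLocalization.map_units _ ⟨g, hg⟩)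
  · rw [← IsLocalization.mk'_spec _ _ s]
    exact (associated_mul_unit_right _ _ (IsLocalization.map_units _ s)).symm

theorem comap_map_toLocalizationCoeffUnit {σ A : Type*} [CommRing A] (P : Ideal A)
    (hP : P.IsPrime) :
    (P.map (toLocalizationCoeffUnit σ A)).comap (toLocalizationCoeffUnit σ A) = P := by
  refine le_antisymm (fun x hx => ?_) Ideal.le_comap_map
  rw [toLocalizationCoeffUnit, ← Ideal.map_map, Ideal.mem_comap, RingHom.comp_apply,
    IsLocalization.algebraMap_mem_map_algebraMap_iff (coeffUnitSubmonoid σ A)] at hx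
  obtain ⟨s, hs, hsx⟩ := hx
  by_contra hxP
  refine hP.ne_top (top_le_iff.mp ((show _ = ⊤ from hs).symm.trans_le ?_))
  rw [Ideal.span_le, Set.range_subset_iff]
  intro i
  have := MvPolynomial.mem_map_C_iff.mp hsx i
  rw [mul_comm, MvPolynomial.coeff_C_mul] at this
  exact (hP.mem_or_mem this).resolve_left hxP

theorem faithfullyFlat_toLocalizationCoeffUnit (σ A : Type*) [CommRing A] :
    (toLocalizationCoeffUnit σ A).FaithfullyFlat := by
  rw [RingHom.FaithfullyFlat.iff_flat_and_comap_surjective]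
  constructor
  · have hC : (MvPolynomial.C : A →+* MvPolynomial σ A).Flat := by
      rw [← MvPolynomial.algebraMap_eq, RingHom.flat_algebraMap_iff]
      infer_instance
    have hL : (algebraMap (MvPolynomial σ A)
        (Localization (coeffUnitSubmonoid σ A))).Flat := by
      rw [RingHom.flat_algebraMap_iff]
      exact IsLocalization.flat _ (coeffUnitSubmonoid σ A)
    exact hC.comp hL
  · intro P
    obtain ⟨Q, hQ, hQP⟩ := (Ideal.comap_map_eq_self_iff_of_isPrime P.asIdeal).mp
      (comap_map_toLocalizationCoeffUnit (σ := σ) P.asIdeal P.isPrime)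
    exact ⟨⟨Q, hQ⟩, PrimeSpectrum.ext hQP⟩

theorem statement_5 (A : Type) [CommRing A] [IsDomain A] [IsPrincipalIdealRing A]
    (hsemilocal : {I : Ideal A | I.IsMaximal}.Finite) (n : ℕ) (hn : 1 ≤ n) :
    -- `S` is a multiplicatively closed set:
    (1 : MvPolynomial (Fin n) A) ∈ coeffUnitSet (Fin n) A ∧
    (∀ f g : MvPolynomial (Fin n) A, f ∈ coeffUnitSet (Fin n) A →
      g ∈ coeffUnitSet (Fin n) A → f * g ∈ coeffUnitSet (Fin n) A) ∧
    -- and the localization `A(x₁,…,xₙ)` at the corresponding submonoid is a principal ideal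
    -- domain with only finitely many maximal ideals, faithfully flat over `A`:
    ∃ M : Submonoid (MvPolynomial (Fin n) A), (M : Set (MvPolynomial (Fin n) A)) =
        coeffUnitSet (Fin n) A ∧
      IsDomain (Localization M) ∧ IsPrincipalIdealRing (Localization M) ∧
      {I : Ideal (Localization M) | I.IsMaximal}.Finite ∧
      (letI : Algebra A (Localization M) :=
        (((algebraMap (MvPolynomial (Fin n) A) (Localization M)).comp
          (MvPolynomial.C : A →+* MvPolynomial (Fin n) A))).toAlgebra
       Module.FaithfullyFlat A (Localization M)) := by
  refine ⟨one_mem (coeffUnitSubmonoid (Fin n) A),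
    fun f g hf hg => (coeffUnitSubmonoid (Fin n) A).mul_mem hf hg,
    coeffUnitSubmonoid (Fin n) A, rfl, ?_, ?_, ?_, ?_⟩
  · exact IsLocalization.isDomain_localization
      (le_nonZeroDivisors_of_noZeroDivisors (zero_notMem_coeffUnitSubmonoid _ _))
  · exact isPrincipalIdealRing_of_associated _ exists_associated_toLocalizationCoeffUnit
  · exact finite_isMaximal_of_associated _ exists_associated_toLocalizationCoeffUnit
      (finite_isPrime_of_finite_isMaximal hsemilocal)
  · exact RingHom.faithfullyFlat_algebraMap_iff.mp
      (faithfullyFlat_toLocalizationCoeffUnit (Fin n) A)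

end
end

section
/- Let A be a semi-local PID (a principal ideal domain with finitely many maximal ideals) and let A(x₁,…,xₙ) be the localization of A[x₁,…,xₙ] at the multiplicative set of polynomials whose coefficients generate the unit ideal of A. Then: (1) the induced map Spec A(x₁,…,xₙ) → Spec A is a bijection on points; (2) for every point b ∈ Spec A with residue field κ(b), the morphism from the fiber of Spec A(x₁,…,xₙ) over b to 𝔸^n_{κ(b)} determined by the images of x₁,…,xₙ has topologically dense image; that is, its image is the generic point of 𝔸^n_{κ(b)}. -/
/-!
Statement 6: for a semi-local PID `A`, `Spec A(x₁,…,xₙ) → Spec A` is a bijection on points,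
and for every point `b ∈ Spec A`, the morphism from the fiber of `Spec A(x₁,…,xₙ)` over `b`
to `𝔸^n_{κ(b)}` determined by the images of `x₁,…,xₙ` has image exactly the generic point of
`𝔸^n_{κ(b)}`.
-/

open AlgebraicGeometry CategoryTheory CategoryTheory.Limits

noncomputable section

section

variable (A : Type) [CommRing A] (n : ℕ) (M : Submonoid (MvPolynomial (Fin n) A))

/-- The natural map `A → A(x₁,…,xₙ) = A[x₁,…,xₙ]_M`. -/
def toLocalization : CommRingCat.of A ⟶ CommRingCat.of (Localization M) :=
  CommRingCat.ofHom ((algebraMap (MvPolynomial (Fin n) A) (Localization M)).comp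
    (MvPolynomial.C : A →+* MvPolynomial (Fin n) A))

/-- The morphism of schemes `Spec A(x₁,…,xₙ) → Spec A`. -/
def specLoc : Spec (CommRingCat.of (Localization M)) ⟶ Spec (CommRingCat.of A) :=
  Spec.map (toLocalization A n M)

variable (b : ↑(Spec (CommRingCat.of A)))

/-- The fiber of `Spec A(x₁,…,xₙ) → Spec A` over the point `b`, i.e.
`Spec (A(x₁,…,xₙ) ⊗_A κ(b))`. -/
def fiberOver : Scheme :=
  pullback (specLoc A n M) ((Spec (CommRingCat.of A)).fromSpecResidueField b)

/-- The morphism from the fiber over `b` to `𝔸ⁿ_{κ(b)}` determined by the images of the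
variables `x₁,…,xₙ`. -/
def fiberToAffine :
    fiberOver A n M b ⟶ 𝔸(Fin n; Spec ((Spec (CommRingCat.of A)).residueField b)) :=
  AffineSpace.homOfVector (pullback.snd _ _)
    (fun i => (pullback.fst (specLoc A n M)
        ((Spec (CommRingCat.of A)).fromSpecResidueField b)).appTop
      ((Scheme.ΓSpecIso (CommRingCat.of (Localization M))).inv
        (algebraMap (MvPolynomial (Fin n) A) (Localization M) (MvPolynomial.X i))))

end

open MvPolynomial in
/-- The extension of a prime ideal to a polynomial ring is prime. -/
theorem isPrime_map_mvPolynomial_C {σ A : Type*} [CommRing A] (p : Ideal A) [p.IsPrime] :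
    (p.map (C : A →+* MvPolynomial σ A)).IsPrime := by
  have h := RingHom.ker_isPrime (MvPolynomial.map (σ := σ) (Ideal.Quotient.mk p))
  rwa [MvPolynomial.ker_map, Ideal.mk_ker] at h

open MvPolynomial in
theorem comap_C_map_mvPolynomial_C {σ A : Type*} [CommRing A] (p : Ideal A) :
    (p.map (C : A →+* MvPolynomial σ A)).comap C = p := by
  ext a
  rw [Ideal.mem_comap, mem_map_C_iff]
  refine ⟨fun h => by simpa using h 0, fun h s => ?_⟩
  classical
  rw [coeff_C]
  split_ifs
  exacts [h, p.zero_mem]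

open MvPolynomial in
theorem disjoint_coeffUnitSet_map_C {σ A : Type*} [CommRing A] {p : Ideal A} (hp : p ≠ ⊤) :
    Disjoint (coeffUnitSet σ A) (p.map (C : A →+* MvPolynomial σ A) : Set (MvPolynomial σ A)) := by
  rw [Set.disjoint_left]
  intro f hf hfp
  refine hp (top_le_iff.mp (hf.symm.le.trans (Ideal.span_le.mpr ?_)))
  rintro _ ⟨s, rfl⟩
  exact mem_map_C_iff.mp hfp s

open MvPolynomial in
/-- Prime avoidance for the extensions of the maximal ideals of a semi-local ring. -/
theorem exists_isMaximal_le_map_C {σ A : Type*} [CommRing A]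
    (hfin : {I : Ideal A | I.IsMaximal}.Finite) {P : Ideal (MvPolynomial σ A)}
    (hP : Disjoint (coeffUnitSet σ A) (P : Set (MvPolynomial σ A))) :
    ∃ m : Ideal A, m.IsMaximal ∧ P ≤ m.map C := by
  refine (Ideal.subset_union_prime_finite hfin (f := fun m => m.map C) ⊥ ⊥
    fun m hm _ _ => ?_).mp fun f hf => ?_
  · have : m.IsPrime := Ideal.IsMaximal.isPrime hm
    exact isPrime_map_mvPolynomial_C m
  · obtain ⟨m, hm, hle⟩ := Ideal.exists_le_maximal _ fun h => Set.disjoint_left.mp hP h hf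
    exact Set.mem_biUnion hm (mem_map_C_iff.mpr fun s => hle (Ideal.subset_span ⟨s, rfl⟩))

open MvPolynomial in
/-- A prime ideal of a polynomial ring over a principal ideal domain that is contained in the
extension of a proper ideal of the base is itself extended from the base. -/
theorem eq_map_C_comap_C_of_le {σ A : Type*} [CommRing A] [IsDomain A] [IsPrincipalIdealRing A]
    {m : Ideal A} (hm : m ≠ ⊤) {P : Ideal (MvPolynomial σ A)} [P.IsPrime] (hle : P ≤ m.map C) :
    (P.comap C).map C = P := by
  refine le_antisymm Ideal.map_comap_le ?_
  obtain ⟨p, rfl⟩ := IsPrincipalIdealRing.principal m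
  rw [Ideal.submodule_span_eq] at hm hle
  rw [Ideal.map_span, Set.image_singleton] at hle
  by_cases hp : C p ∈ P
  · refine hle.trans ?_
    rw [Ideal.span_singleton_le_iff_mem]
    exact Ideal.mem_map_of_mem C hp
  · intro f hf
    suffices f = 0 from this ▸ zero_mem _
    by_contra hf0
    have hunit : ¬ IsUnit (C p : MvPolynomial σ A) := fun h =>
      hm (Ideal.span_singleton_eq_top.mpr (by simpa using h.map (constantCoeff (σ := σ))))
    obtain ⟨k, hk⟩ := FiniteMultiplicity.of_not_isUnit hunit hf0
    have hdiv : ∀ k : ℕ, ∃ g ∈ P, f = C p ^ k * g := by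
      intro k
      induction k with
      | zero => exact ⟨f, hf, by simp⟩
      | succ k ih =>
        obtain ⟨g, hg, rfl⟩ := ih
        obtain ⟨g', rfl⟩ := Ideal.mem_span_singleton.mp (hle hg)
        exact ⟨g', ((‹P.IsPrime›.mem_or_mem hg).resolve_left hp), by ring⟩
    obtain ⟨g, -, hg⟩ := hdiv (k + 1)
    exact hk ⟨g, hg⟩

open MvPolynomial in
/-- Clearing denominators in the coefficients of a polynomial over a residue field. -/
theorem exists_C_mul_eq_map {σ A K : Type*} [CommRing A] [Field K] (φ : A →+* K)
    (hφ : ∀ k, ∃ a s, φ s ≠ 0 ∧ φ s * k = φ a) (f : MvPolynomial σ K) :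
    ∃ (s : A) (g : MvPolynomial σ A), φ s ≠ 0 ∧ C (φ s) * f = map φ g := by
  induction f using MvPolynomial.induction_on with
  | C k =>
    obtain ⟨a, s, hs, h⟩ := hφ k
    exact ⟨s, C a, hs, by rw [← C_mul, h, map_C]⟩
  | add f f' ih ih' =>
    obtain ⟨s, g, hs, h⟩ := ih
    obtain ⟨s', g', hs', h'⟩ := ih'
    refine ⟨s * s', C s' * g + C s * g', by simp [hs, hs'], ?_⟩
    simp only [map_mul, map_add, map_C, ← h, ← h']
    ring
  | mul_X f i ih =>
    obtain ⟨s, g, hs, h⟩ := ih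
    exact ⟨s, g * X i, hs, by rw [map_mul, map_X, ← h, mul_assoc]⟩

open MvPolynomial in
/-- An ideal of `K[x]` whose contraction to `A[x]` is extended from the kernel of `A → K` is zero,
when every element of `K` is a fraction of elements coming from `A`. -/
theorem eq_bot_of_comap_map_le {σ A K : Type*} [CommRing A] [Field K] (φ : A →+* K)
    (hφ : ∀ k, ∃ a s, φ s ≠ 0 ∧ φ s * k = φ a) {q : Ideal (MvPolynomial σ K)}
    (hq : q.comap (map φ) ≤ (RingHom.ker φ).map C) : q = ⊥ := by
  refine (Submodule.eq_bot_iff _).mpr fun f hf => ?_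
  obtain ⟨s, g, hs, h⟩ := exists_C_mul_eq_map φ hφ f
  have hg : g ∈ RingHom.ker (map (σ := σ) φ) := by
    rw [MvPolynomial.ker_map]
    refine hq (Ideal.mem_comap.mpr ?_)
    rw [← h]
    exact q.mul_mem_left _ hf
  rw [RingHom.mem_ker.mp hg] at h
  exact (mul_eq_zero.mp h).resolve_left (by simpa using hs)

/-- The inclusion of the residue field at a point of an affine scheme is induced by a ring
homomorphism whose kernel is the corresponding prime ideal, and all elements of the residue field
are fractions of elements in its range. -/
theorem exists_specMap_eq_fromSpecResidueField (R : CommRingCat) (b : Spec R) :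
    ∃ φ : R ⟶ (Spec R).residueField b, Spec.map φ = (Spec R).fromSpecResidueField b ∧
      RingHom.ker φ.hom = b.asIdeal ∧
      ∀ k, ∃ a s, φ.hom s ≠ 0 ∧ φ.hom s * k = φ.hom a := by
  have : b.asIdeal.IsPrime := b.isPrime
  let e := Scheme.Spec.residueFieldIso R b
  have he : Function.Injective e.inv.hom := e.symm.commRingCatIsoToRingEquiv.injective
  refine ⟨CommRingCat.ofHom (algebraMap R b.asIdeal.ResidueField) ≫ e.inv, ?_, ?_, fun k => ?_⟩
  · rw [Spec.map_comp]
    exact Scheme.Spec.map_residueFieldIso_inv_eq_fromSpecResidueField R b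
  · refine Ideal.ext fun a => ?_
    simp [RingHom.mem_ker, map_eq_zero_iff _ he]
  · obtain ⟨a, s, hs, h⟩ := IsFractionRing.div_surjective (A := R ⧸ b.asIdeal) (e.hom.hom k)
    obtain ⟨a, rfl⟩ := Ideal.Quotient.mk_surjective a
    obtain ⟨s, rfl⟩ := Ideal.Quotient.mk_surjective s
    have hs0 : algebraMap R b.asIdeal.ResidueField s ≠ 0 := by
      have := nonZeroDivisors.ne_zero hs
      simpa [Ideal.Quotient.eq_zero_iff_mem] using this
    refine ⟨a, s, ?_, ?_⟩
    · simpa [map_eq_zero_iff _ he] using hs0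
    · have hk : k = e.inv.hom (e.hom.hom k) := by
        simp
      rw [hk, CommRingCat.hom_comp, RingHom.comp_apply, RingHom.comp_apply, ← map_mul, ← h]
      congr 1
      exact mul_div_cancel₀ _ hs0

/-- A morphism to affine space over `S` whose coordinates come from a map `X ⟶ Spec B` and a ring
homomorphism `R[x] → B` is compatible with the projection to affine space over `R`. -/
theorem homOfVector_comp_map_specMap {σ : Type} {X : Scheme.{0}} {R S B : CommRingCat.{0}}
    (φ : R ⟶ S) (ψ : CommRingCat.of (MvPolynomial σ R) ⟶ B) (f : X ⟶ Spec B) (g : X ⟶ Spec S)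
    (h : f ≫ Spec.map (CommRingCat.ofHom MvPolynomial.C ≫ ψ) = g ≫ Spec.map φ) :
    AffineSpace.homOfVector g
        (fun i => f.appTop ((Scheme.ΓSpecIso B).inv (ψ.hom (MvPolynomial.X i)))) ≫
        AffineSpace.map σ (Spec.map φ) =
      f ≫ Spec.map ψ ≫ (AffineSpace.SpecIso σ R).inv := by
  apply AffineSpace.hom_ext
  · simp only [Category.assoc, AffineSpace.map_over, AffineSpace.homOfVector_over_assoc,
      AffineSpace.SpecIso_inv_over]
    rw [← Spec.map_comp, h]
  · intro i
    simp only [Scheme.Hom.comp_appTop, CommRingCat.comp_apply]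
    rw [AffineSpace.map_appTop_coord, AffineSpace.SpecIso_inv_appTop_coord,
      AffineSpace.homOfVector_appTop_coord]
    exact congrArg f.appTop (congrArg (fun k => k (MvPolynomial.X i))
      (Scheme.ΓSpecIso_inv_naturality ψ))

/-- The prime ideal of `A[x]` below a point of `Spec A(x)` is extended from its image in
`Spec A`. -/
theorem comap_asIdeal_eq_map_specLoc (A : Type) [CommRing A] [IsDomain A]
    [IsPrincipalIdealRing A] (hsemilocal : {I : Ideal A | I.IsMaximal}.Finite) (n : ℕ)
    (M : Submonoid (MvPolynomial (Fin n) A))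
    (hM : (M : Set (MvPolynomial (Fin n) A)) = coeffUnitSet (Fin n) A)
    (z : ↑(Spec (CommRingCat.of (Localization M)))) :
    z.asIdeal.comap (algebraMap (MvPolynomial (Fin n) A) (Localization M)) =
      ((specLoc A n M z).asIdeal : Ideal A).map MvPolynomial.C := by
  have hprime := z.isPrime.comap (algebraMap (MvPolynomial (Fin n) A) (Localization M))
  have hdisj := ((IsLocalization.isPrime_iff_isPrime_disjoint M (Localization M) z.asIdeal).mp
    z.isPrime).2
  rw [hM] at hdisj
  obtain ⟨m, hm, hle⟩ := exists_isMaximal_le_map_C hsemilocal hdisj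
  exact (eq_map_C_comap_C_of_le hm.ne_top hle).symm

theorem specLoc_bijective (A : Type) [CommRing A] [IsDomain A]
    [IsPrincipalIdealRing A] (hsemilocal : {I : Ideal A | I.IsMaximal}.Finite) (n : ℕ)
    (M : Submonoid (MvPolynomial (Fin n) A))
    (hM : (M : Set (MvPolynomial (Fin n) A)) = coeffUnitSet (Fin n) A) :
    Function.Bijective (specLoc A n M) := by
  constructor
  · intro z z' h
    refine PrimeSpectrum.localization_comap_injective (Localization M) M (PrimeSpectrum.ext ?_)
    refine (comap_asIdeal_eq_map_specLoc A hsemilocal n M hM z).trans ?_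
    rw [h]
    exact (comap_asIdeal_eq_map_specLoc A hsemilocal n M hM z').symm
  · intro b
    have := b.isPrime
    have hP := isPrime_map_mvPolynomial_C (σ := Fin n) (A := A) b.asIdeal
    obtain ⟨z, hz⟩ : (⟨_, hP⟩ : PrimeSpectrum (MvPolynomial (Fin n) A)) ∈
        Set.range (PrimeSpectrum.comap (algebraMap _ (Localization M))) := by
      rw [PrimeSpectrum.localization_comap_range _ M, Set.mem_ofPred_eq, hM]
      exact disjoint_coeffUnitSet_map_C b.isPrime.ne_top
    refine ⟨z, PrimeSpectrum.ext ?_⟩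
    have h := congrArg (fun x => x.asIdeal.comap MvPolynomial.C) hz
    exact h.trans (comap_C_map_mvPolynomial_C _)

/-- Every point of the fiber over `b` maps to the zero ideal of the polynomial ring over the
residue field. -/
theorem specIso_hom_fiberToAffine_asIdeal (A : Type) [CommRing A] [IsDomain A]
    [IsPrincipalIdealRing A] (hsemilocal : {I : Ideal A | I.IsMaximal}.Finite) (n : ℕ)
    (M : Submonoid (MvPolynomial (Fin n) A))
    (hM : (M : Set (MvPolynomial (Fin n) A)) = coeffUnitSet (Fin n) A)
    (b : ↑(Spec (CommRingCat.of A))) (x : ↑(fiberOver A n M b)) :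
    ((AffineSpace.SpecIso (Fin n) _).hom (fiberToAffine A n M b x)).asIdeal = ⊥ := by
  obtain ⟨φ, hφ, hker, hfrac⟩ := exists_specMap_eq_fromSpecResidueField (CommRingCat.of A) b
  let f := (specLoc A n M).fiberι b
  let F : (specLoc A n M).fiber b ⟶ 𝔸(Fin n; Spec ((Spec (CommRingCat.of A)).residueField b)) :=
    fiberToAffine A n M b
  let ψ := CommRingCat.ofHom (algebraMap (MvPolynomial (Fin n) A) (Localization M))
  have hcomp : F ≫ AffineSpace.map (Fin n) (Spec.map φ) =
      f ≫ Spec.map ψ ≫ (AffineSpace.SpecIso (Fin n) (CommRingCat.of A)).inv :=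
    homOfVector_comp_map_specMap φ ψ f ((specLoc A n M).fiberToSpecResidueField b)
      (by rw [hφ]; exact pullback.condition)
  rw [AffineSpace.map_SpecMap, ← Category.assoc, ← Category.assoc, ← Category.assoc,
    Iso.cancel_iso_inv_right] at hcomp
  have hx := congrArg PrimeSpectrum.asIdeal (congrArg (fun f => f x) hcomp)
  refine eq_bot_of_comap_map_le φ.hom hfrac ?_
  have hb : specLoc A n M ((specLoc A n M).fiberι b x) = b := by
    have : (specLoc A n M).fiberι b x ∈ Set.range ((specLoc A n M).fiberι b) := ⟨x, rfl⟩
    rwa [Scheme.Hom.range_fiberι] at this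
  have hmap := comap_asIdeal_eq_map_specLoc A hsemilocal n M hM ((specLoc A n M).fiberι b x)
  rw [hb, ← hker] at hmap
  exact (hx.trans hmap).le

theorem statement_6 (A : Type) [CommRing A] [IsDomain A] [IsPrincipalIdealRing A]
    (hsemilocal : {I : Ideal A | I.IsMaximal}.Finite) (n : ℕ) (hn : 1 ≤ n)
    (M : Submonoid (MvPolynomial (Fin n) A))
    (hM : (M : Set (MvPolynomial (Fin n) A)) = coeffUnitSet (Fin n) A) :
    -- (1): `Spec A(x₁,…,xₙ) → Spec A` is a bijection on points
    Function.Bijective (specLoc A n M).base ∧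
    -- (2): for every point `b` of `Spec A`, the image of the fiber over `b` in `𝔸ⁿ_{κ(b)}` is
    -- exactly the generic point of `𝔸ⁿ_{κ(b)}` (the unique point whose closure is dense):
    ∀ b : ↑(Spec (CommRingCat.of A)),
      ∃ y, Set.range (fiberToAffine A n M b).base = {y} ∧
        Dense ({y} : Set ↑(𝔸(Fin n; Spec ((Spec (CommRingCat.of A)).residueField b)))) := by
  have hbij := specLoc_bijective A hsemilocal n M hM
  refine ⟨hbij, fun b => ?_⟩
  obtain ⟨z, hz⟩ := hbij.2 b
  let x : ↑(fiberOver A n M b) := ((specLoc A n M).fiberHomeo b).symm ⟨z, hz⟩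
  have hx : ∀ x' : ↑(fiberOver A n M b), x' = x := fun x' =>
    ((specLoc A n M).fiberHomeo b).injective (Subtype.ext (hbij.1
      ((((specLoc A n M).fiberHomeo b) x').2.trans (((specLoc A n M).fiberHomeo b) x).2.symm)))
  refine ⟨fiberToAffine A n M b x, ?_, ?_⟩
  · ext y
    constructor
    · rintro ⟨x', rfl⟩
      rw [hx x']
      rfl
    · rintro rfl
      exact ⟨x, rfl⟩
  · let e := (AffineSpace.SpecIso (Fin n)
      ((Spec (CommRingCat.of A)).residueField b)).hom.homeomorph
    rw [dense_iff_closure_eq, ← e.injective.image_injective.eq_iff, e.image_closure,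
      Set.image_singleton, Set.image_univ, e.surjective.range_eq]
    have h0 := specIso_hom_fiberToAffine_asIdeal A hsemilocal n M hM b x
    refine (PrimeSpectrum.closure_singleton _).trans ?_
    refine (congrArg (fun I : Ideal _ => PrimeSpectrum.zeroLocus (SetLike.coe I)) h0).trans ?_
    exact PrimeSpectrum.zeroLocus_bot

end
end

section
/- Let A be a commutative noetherian ring, d ≥ 1, and F ∈ A[X₀,X₁,X₂] a homogeneous polynomial of degree d such that for every prime 𝔭 of A the image of F in κ(𝔭)[X₀,X₁,X₂] is non-zero, where κ(𝔭) is the residue field at 𝔭. Fix positive integers d₁,…,d_r with d₁+⋯+d_r = d. Then the set of primes 𝔭 ∈ Spec A such that the image of F in κ̄(𝔭)[X₀,X₁,X₂] (κ̄(𝔭) an algebraic closure of κ(𝔭)) factors as a product F₁⋯F_r of homogeneous polynomials with deg F_j = d_j is a Zariski-closed subset of Spec A. Moreover, the set of those primes 𝔭 for which such a factorization exists with every F_j irreducible in κ̄(𝔭)[X₀,X₁,X₂] is open in this closed subset. -/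
/-!
Statement 17: for a noetherian ring `A` and a degree-`d` homogeneous `F ∈ A[X₀,X₁,X₂]` which
is non-zero in every residue field, and a partition `d = d₁ + ⋯ + d_r`, the locus of primes
`𝔭` where the image of `F` over an algebraic closure of `κ(𝔭)` factors into homogeneous
factors of degrees `d₁,…,d_r` is closed, and the sublocus where the factors can be chosen
irreducible is open in it.
-/

noncomputable section

section

variable (A : Type) [CommRing A] (p : PrimeSpectrum A)

/-- The residue field `κ(𝔭)` of `Spec A` at `𝔭`, realized as `Frac(A/𝔭)`. -/
abbrev resField : Type := FractionRing (A ⧸ p.asIdeal)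

/-- An algebraic closure `κ̄(𝔭)` of the residue field at `𝔭`. -/
abbrev resFieldBar : Type := AlgebraicClosure (resField A p)

/-- The canonical map `A → κ̄(𝔭)`. -/
def toResBar : A →+* resFieldBar A p :=
  (algebraMap (resField A p) (resFieldBar A p)).comp
    ((algebraMap (A ⧸ p.asIdeal) (resField A p)).comp (Ideal.Quotient.mk p.asIdeal))

variable (d : ℕ) (F : MvPolynomial (Fin 3) A) (r : ℕ) (dd : Fin r → ℕ)

/-- `F` factors over `κ̄(𝔭)` into homogeneous polynomials of degrees `d₁,…,d_r`. -/
def FactorsAt : Prop :=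
  ∃ Fj : Fin r → MvPolynomial (Fin 3) (resFieldBar A p),
    (∀ j, (Fj j).IsHomogeneous (dd j)) ∧
      MvPolynomial.map (toResBar A p) F = ∏ j, Fj j

/-- `F` factors over `κ̄(𝔭)` into irreducible homogeneous polynomials of degrees
`d₁,…,d_r`. -/
def IrredFactorsAt : Prop :=
  ∃ Fj : Fin r → MvPolynomial (Fin 3) (resFieldBar A p),
    (∀ j, (Fj j).IsHomogeneous (dd j)) ∧ (∀ j, Irreducible (Fj j)) ∧
      MvPolynomial.map (toResBar A p) F = ∏ j, Fj j

end

namespace HomogeneousFactorization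

open MvPolynomial

/-- `G` is a product of homogeneous polynomials of degrees `n j`, `j : ι`. -/
def HasFactorization {ι σ R : Type*} [Fintype ι] [CommRing R] (n : ι → ℕ)
    (G : MvPolynomial σ R) : Prop :=
  ∃ f : ι → MvPolynomial σ R, (∀ j, (f j).IsHomogeneous (n j)) ∧ G = ∏ j, f j

section General

variable {ι σ R S : Type*} [Fintype ι] [CommRing R] [CommRing S] {n : ι → ℕ}

theorem HasFactorization.map {G : MvPolynomial σ R} (h : HasFactorization n G) (φ : R →+* S) :
    HasFactorization n (MvPolynomial.map φ G) := by
  obtain ⟨f, hf, rfl⟩ := h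
  exact ⟨fun j => MvPolynomial.map φ (f j), fun j => (hf j).map φ, by simp [map_prod]⟩

theorem HasFactorization.C_mul [Nonempty ι] {G : MvPolynomial σ R} (h : HasFactorization n G)
    (c : R) : HasFactorization n (C c * G) := by
  classical
  obtain ⟨f, hf, rfl⟩ := h
  obtain ⟨i⟩ := ‹Nonempty ι›
  refine ⟨fun j => C (if j = i then c else 1) * f j, fun j => (hf j).C_mul _, ?_⟩
  rw [Finset.prod_mul_distrib]
  simp [← map_prod]

end General

section Universal

variable {ι σ R S : Type*} [CommRing R] [CommRing S] [Fintype σ] (n : ι → ℕ)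

open Classical in
/-- Indices for the coefficients of a family of homogeneous polynomials of degrees `n j`. -/
abbrev CoeffIndex (σ : Type*) [Fintype σ] (n : ι → ℕ) : Type _ :=
  Σ j : ι, {s : σ →₀ ℕ // s ∈ Finset.finsuppAntidiag Finset.univ (n j)}

/-- The homogeneous polynomial of degree `n j` with coefficients `c`. -/
def polyOfCoeffs (c : CoeffIndex σ n → R) (j : ι) : MvPolynomial σ R :=
  ∑ s, monomial s.1 (c ⟨j, s⟩)

theorem polyOfCoeffs_isHomogeneous (c : CoeffIndex σ n → R) (j : ι) :
    (polyOfCoeffs n c j).IsHomogeneous (n j) := by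
  classical
  refine IsHomogeneous.sum _ _ _ fun s _ => isHomogeneous_monomial _ ?_
  have h := s.2
  rw [Finset.mem_finsuppAntidiag] at h
  exact (Finsupp.degree_eq_sum _).trans h.1

theorem map_polyOfCoeffs (φ : R →+* S) (c : CoeffIndex σ n → R) (j : ι) :
    map φ (polyOfCoeffs n c j) = polyOfCoeffs n (φ ∘ c) j := by
  simp [polyOfCoeffs, map_sum, map_monomial]

variable {n} in
theorem polyOfCoeffs_coeff {f : ι → MvPolynomial σ R} (hf : ∀ j, (f j).IsHomogeneous (n j))
    (j : ι) : polyOfCoeffs n (fun x => (f x.1).coeff x.2.1) j = f j := by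
  classical
  rw [polyOfCoeffs, Finset.sum_coe_sort (Finset.finsuppAntidiag Finset.univ (n j))
    (fun s => monomial s ((f j).coeff s))]
  conv_rhs => rw [(f j).as_sum]
  symm
  refine Finset.sum_subset (fun s hs => ?_) fun s _ hs => ?_
  · rw [Finset.mem_finsuppAntidiag, ← Finsupp.degree_eq_sum]
    refine ⟨?_, Finset.subset_univ _⟩
    by_contra h
    exact (mem_support_iff.mp hs) ((hf j).coeff_eq_zero h)
  · rw [notMem_support_iff.mp hs, monomial_zero]

variable [Fintype ι]

/-- The ideal of relations expressing that the generic homogeneous polynomials of degrees `n j`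
have product `G`. -/
def factorizationIdeal (G : MvPolynomial σ R) : Ideal (MvPolynomial (CoeffIndex σ n) R) :=
  Ideal.span (Set.range fun s => coeff s (map C G - ∏ j, polyOfCoeffs n X j))

/-- The `R`-algebra representing factorizations of `G` into homogeneous polynomials of
degrees `n j`. -/
def FactorizationAlgebra (G : MvPolynomial σ R) : Type _ :=
  MvPolynomial (CoeffIndex σ n) R ⧸ factorizationIdeal n G

instance (G : MvPolynomial σ R) : CommRing (FactorizationAlgebra n G) :=
  inferInstanceAs (CommRing (MvPolynomial (CoeffIndex σ n) R ⧸ factorizationIdeal n G))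

instance (G : MvPolynomial σ R) : Algebra R (FactorizationAlgebra n G) :=
  inferInstanceAs (Algebra R (MvPolynomial (CoeffIndex σ n) R ⧸ factorizationIdeal n G))

instance (G : MvPolynomial σ R) : Algebra.FiniteType R (FactorizationAlgebra n G) :=
  inferInstanceAs
    (Algebra.FiniteType R (MvPolynomial (CoeffIndex σ n) R ⧸ factorizationIdeal n G))

theorem hasFactorization_map_iff (G : MvPolynomial σ R) (φ : R →+* S) :
    HasFactorization n (map φ G) ↔
      ∃ ψ : FactorizationAlgebra n G →+* S, ψ.comp (algebraMap R _) = φ := by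
  constructor
  · rintro ⟨f, hf, hG⟩
    let c : CoeffIndex σ n → S := fun x => (f x.1).coeff x.2.1
    let e : MvPolynomial (CoeffIndex σ n) R →+* S := eval₂Hom φ c
    have he : ∀ a ∈ factorizationIdeal n G, e a = 0 := by
      intro a ha
      suffices factorizationIdeal n G ≤ RingHom.ker e from this ha
      refine Ideal.span_le.mpr ?_
      rintro _ ⟨s, rfl⟩
      have h1 : e.comp C = φ := by ext; simp [e]
      have h2 : (e ∘ X : CoeffIndex σ n → S) = c := by ext; simp [e]
      rw [SetLike.mem_coe, RingHom.mem_ker, ← coeff_map, map_sub, map_prod, map_map, h1, hG]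
      simp_rw [map_polyOfCoeffs, h2, c, polyOfCoeffs_coeff hf]
      simp
    refine ⟨Ideal.Quotient.lift _ e he, ?_⟩
    ext a
    change Ideal.Quotient.lift _ e he (Ideal.Quotient.mk _ (C a)) = φ a
    simp [e]
  · rintro ⟨ψ, rfl⟩
    let q : MvPolynomial (CoeffIndex σ n) R →+* FactorizationAlgebra n G := Ideal.Quotient.mk _
    have hq : algebraMap R (FactorizationAlgebra n G) = q.comp C := rfl
    suffices HasFactorization n (map (algebraMap R (FactorizationAlgebra n G)) G) by
      simpa [map_map] using this.map ψ
    refine ⟨polyOfCoeffs n (q ∘ X), polyOfCoeffs_isHomogeneous n _, ?_⟩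
    rw [← sub_eq_zero, hq, ← map_map]
    simp_rw [← map_polyOfCoeffs]
    rw [← map_prod, ← map_sub]
    ext s
    rw [coeff_map, coeff_zero]
    exact Ideal.Quotient.eq_zero_iff_mem.mpr (Ideal.subset_span ⟨s, rfl⟩)

theorem nonempty_algHom_of_isAlgClosed (k B K : Type*) [Field k] [CommRing B] [Nontrivial B]
    [Field K] [IsAlgClosed K] [Algebra k K] [Algebra k B] [Algebra.FiniteType k B] :
    Nonempty (B →ₐ[k] K) := by
  obtain ⟨m, hm⟩ := Ideal.exists_maximal B
  let := Ideal.Quotient.field m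
  have : Module.Finite k (B ⧸ m) := finite_of_finite_type_of_isJacobsonRing _ _
  exact ⟨(IsAlgClosed.lift : (B ⧸ m) →ₐ[k] K).comp (Ideal.Quotient.mkₐ k m)⟩

variable {n} in
/-- A factorization over some extension of a field `k` yields one over any algebraically closed
extension of `k`. -/
theorem HasFactorization.of_isAlgClosed {k L K : Type*} [Field k] [CommRing L] [Nontrivial L]
    [Field K] [IsAlgClosed K] [Algebra k K] {G : MvPolynomial σ k} (φ : k →+* L)
    (h : HasFactorization n (MvPolynomial.map φ G)) :
    HasFactorization n (MvPolynomial.map (algebraMap k K) G) := by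
  obtain ⟨ψ, -⟩ := (hasFactorization_map_iff n G φ).mp h
  have : Nontrivial (FactorizationAlgebra n G) := ψ.domain_nontrivial
  obtain ⟨g⟩ := nonempty_algHom_of_isAlgClosed k (FactorizationAlgebra n G) K
  exact (hasFactorization_map_iff n G _).mpr ⟨g.toRingHom, g.comp_algebraMap⟩

end Universal

section Valuation

variable {ι σ K : Type*} [Fintype ι] [Field K] {n : ι → ℕ}

/-- A nonzero polynomial over the fraction field of a valuation ring is a scalar multiple of a
polynomial over the valuation ring with nonzero reduction. -/
theorem exists_eq_C_mul_map (V : ValuationSubring K) {f : MvPolynomial σ K} (hf : f ≠ 0) :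
    ∃ (c : K) (g : MvPolynomial σ V), c ≠ 0 ∧ f = C c * map V.subtype g ∧
      map (IsLocalRing.residue V) g ≠ 0 := by
  obtain ⟨s, hs, hmax⟩ := f.support.exists_max_image (fun s => V.valuation (f.coeff s))
    (support_nonempty.mpr hf)
  have hc : f.coeff s ≠ 0 := mem_support_iff.mp hs
  have hle : ∀ t, V.valuation (f.coeff t) ≤ V.valuation (f.coeff s) := by
    intro t
    by_cases ht : t ∈ f.support
    · exact hmax t ht
    · simp [notMem_support_iff.mp ht]
  have hmem : C (f.coeff s)⁻¹ * f ∈ Set.range (map (σ := σ) V.subtype) := by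
    rw [mem_range_map_iff_coeffs_subset]
    intro a ha
    rw [Finset.mem_coe, mem_coeffs_iff] at ha
    obtain ⟨t, -, rfl⟩ := ha
    refine ⟨⟨(C (f.coeff s)⁻¹ * f).coeff t, ?_⟩, rfl⟩
    rw [← V.valuation_le_one_iff, coeff_C_mul, map_mul, map_inv₀]
    have : V.valuation (f.coeff s) ≠ 0 := by simpa using hc
    calc _ ≤ (V.valuation (f.coeff s))⁻¹ * V.valuation (f.coeff s) := by gcongr; exact hle t
      _ = 1 := inv_mul_cancel₀ this
  obtain ⟨g, hg⟩ := hmem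
  refine ⟨f.coeff s, g, hc, ?_, ?_⟩
  · rw [hg, ← mul_assoc, ← MvPolynomial.C_mul, mul_inv_cancel₀ hc, C_1, one_mul]
  · intro h0
    have h1 : V.subtype (g.coeff s) = 1 := by
      rw [← coeff_map, hg, coeff_C_mul, inv_mul_cancel₀ hc]
    have h2 : g.coeff s = 1 := Subtype.ext h1
    have h3 : (map (IsLocalRing.residue V) g).coeff s = 1 := by rw [coeff_map, h2, map_one]
    simp [h0] at h3

/-- A factorization over the fraction field of a valuation ring specializes to the residue
field. -/
theorem HasFactorization.residue [Nonempty ι] (V : ValuationSubring K) {G : MvPolynomial σ V}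
    (hG : G ≠ 0) (h : HasFactorization n (MvPolynomial.map V.subtype G)) :
    HasFactorization n (MvPolynomial.map (IsLocalRing.residue V) G) := by
  have hinj : Function.Injective (MvPolynomial.map (σ := σ) V.subtype) :=
    map_injective _ Subtype.val_injective
  obtain ⟨f, hf, hfG⟩ := h
  have hf0 : ∀ j, f j ≠ 0 := by
    have : ∏ j, f j ≠ 0 := by
      rw [← hfG]
      exact (map_ne_zero_iff _ hinj).mpr hG
    exact fun j => Finset.prod_ne_zero_iff.mp this j (Finset.mem_univ j)
  choose c g hc hcg hg using fun j => exists_eq_C_mul_map V (hf0 j)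
  have hprod : MvPolynomial.map V.subtype G =
      C (∏ j, c j) * MvPolynomial.map V.subtype (∏ j, g j) := by
    rw [hfG, map_prod, map_prod, ← Finset.prod_mul_distrib]
    exact Finset.prod_congr rfl fun j _ => hcg j
  have hres : MvPolynomial.map (IsLocalRing.residue V) (∏ j, g j) ≠ 0 := by
    rw [map_prod]
    exact Finset.prod_ne_zero_iff.mpr fun j _ => hg j
  obtain ⟨s, hs⟩ := ne_zero_iff.mp hres
  rw [coeff_map, IsLocalRing.residue_ne_zero_iff_isUnit] at hs
  obtain ⟨u, hu⟩ := hs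
  have hcV : ∏ j, c j = V.subtype (G.coeff s * ↑u⁻¹) := by
    have h1 := congrArg (coeff s) hprod
    rw [coeff_map, coeff_C_mul, coeff_map, ← hu] at h1
    rw [map_mul, h1, mul_assoc, ← map_mul, Units.mul_inv, map_one, mul_one]
  rw [hcV, ← map_C, ← map_mul] at hprod
  rw [hinj hprod, map_mul, map_C]
  refine HomogeneousFactorization.HasFactorization.C_mul ?_ _
  refine HasFactorization.map ⟨g, fun j => ?_, rfl⟩ _
  refine IsHomogeneous.of_map (f := V.subtype) Subtype.val_injective ?_
  have h1 := (hf j).C_mul (c j)⁻¹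
  rwa [hcg j, ← mul_assoc, ← MvPolynomial.C_mul, inv_mul_cancel₀ (hc j), C_1, one_mul] at h1

end Valuation

section Locus

/-- Every prime containing the kernel of a ring homomorphism to a field is the center of a
valuation ring of that field. -/
theorem exists_valuationSubring_comap_maximalIdeal {R K : Type*} [CommRing R] [Field K]
    (f : R →+* K) (q : PrimeSpectrum R) (hq : RingHom.ker f ≤ q.asIdeal) :
    ∃ (V : ValuationSubring K) (φ : R →+* V), V.subtype.comp φ = f ∧
      (IsLocalRing.maximalIdeal V).comap φ = q.asIdeal := by
  have hunit : ∀ y : q.asIdeal.primeCompl, IsUnit (f y) := fun y =>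
    isUnit_iff_ne_zero.mpr fun hy => y.2 (hq hy)
  let g : Localization.AtPrime q.asIdeal →+* K := IsLocalization.lift hunit
  obtain ⟨V, hV, hloc⟩ := IsLocalRing.exists_factor_valuationRing g
  let gV : Localization.AtPrime q.asIdeal →+* V := g.codRestrict V.toSubring hV
  have hlocV : IsLocalHom gV := hloc
  refine ⟨V, gV.comp (algebraMap R _), ?_, ?_⟩
  · ext a
    exact IsLocalization.lift_eq hunit a
  · have hmax : (IsLocalRing.maximalIdeal V).comap gV = IsLocalRing.maximalIdeal _ :=
      ((IsLocalRing.local_hom_TFAE gV).out 0 4).mp hlocV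
    rw [← Ideal.comap_comap, hmax]
    exact IsLocalization.AtPrime.under_maximalIdeal _ _

variable {A : Type} [CommRing A]

theorem ker_toResBar (p : PrimeSpectrum A) : RingHom.ker (toResBar A p) = p.asIdeal := by
  ext a
  rw [RingHom.mem_ker, toResBar, RingHom.comp_apply, RingHom.comp_apply,
    map_eq_zero_iff _ (algebraMap (resField A p) (resFieldBar A p)).injective,
    map_eq_zero_iff _ (IsFractionRing.injective (A ⧸ p.asIdeal) (resField A p)),
    Ideal.Quotient.eq_zero_iff_mem]

variable {r : ℕ} {n : Fin r → ℕ} {F : MvPolynomial (Fin 3) A}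

/-- A factorization over any field-valued point with kernel `p` descends to `κ̄(p)`. -/
theorem factorsAt_of_ker_eq {L : Type*} [Field L] (φ : A →+* L) (p : PrimeSpectrum A)
    (hφ : RingHom.ker φ = p.asIdeal) (h : HasFactorization n (map φ F)) :
    FactorsAt A p F r n := by
  let φ₁ : A ⧸ p.asIdeal →+* L := Ideal.Quotient.lift _ φ fun a ha => by
    rwa [← hφ, RingHom.mem_ker] at ha
  have hφ₁ : Function.Injective φ₁ :=
    RingHom.lift_injective_of_ker_le_ideal _ _ hφ.le
  let φ₂ : resField A p →+* L := IsFractionRing.lift hφ₁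
  have hφ₂ : φ₂.comp ((algebraMap (A ⧸ p.asIdeal) (resField A p)).comp
      (Ideal.Quotient.mk p.asIdeal)) = φ := by
    ext a
    simp [φ₂, φ₁]
  rw [← hφ₂, ← map_map] at h
  have := h.of_isAlgClosed (K := resFieldBar A p)
  rwa [map_map] at this

theorem setOf_factorsAt_eq_range :
    {p : PrimeSpectrum A | FactorsAt A p F r n} =
      Set.range (PrimeSpectrum.comap (algebraMap A (FactorizationAlgebra n F))) := by
  ext p
  constructor
  · intro hp
    obtain ⟨ψ, hψ⟩ := (hasFactorization_map_iff n F (toResBar A p)).mp hp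
    refine ⟨⟨RingHom.ker ψ, RingHom.ker_isPrime ψ⟩, ?_⟩
    ext1
    rw [PrimeSpectrum.comap_asIdeal, RingHom.comap_ker, hψ, ker_toResBar]
  · rintro ⟨P, rfl⟩
    let ψ : FactorizationAlgebra n F →+* FractionRing (FactorizationAlgebra n F ⧸ P.asIdeal) :=
      (algebraMap _ _).comp (Ideal.Quotient.mk P.asIdeal)
    refine factorsAt_of_ker_eq (ψ.comp (algebraMap A _)) _ ?_
      ((hasFactorization_map_iff n F _).mpr ⟨ψ, rfl⟩)
    rw [PrimeSpectrum.comap_asIdeal, ← RingHom.comap_ker]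
    congr 1
    ext a
    rw [RingHom.mem_ker, RingHom.comp_apply,
      map_eq_zero_iff _ (IsFractionRing.injective (FactorizationAlgebra n F ⧸ P.asIdeal) _),
      Ideal.Quotient.eq_zero_iff_mem]

theorem map_toResBar_ne_zero {p : PrimeSpectrum A}
    (h : map ((algebraMap (A ⧸ p.asIdeal) (resField A p)).comp
      (Ideal.Quotient.mk p.asIdeal)) F ≠ 0) :
    map (toResBar A p) F ≠ 0 := by
  rw [toResBar, ← map_map]
  exact (map_ne_zero_iff _ (map_injective _ (RingHom.injective _))).mpr h

theorem isClosed_setOf_factorsAt [Nonempty (Fin r)]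
    (hF : ∀ p : PrimeSpectrum A, map (toResBar A p) F ≠ 0) :
    IsClosed {p : PrimeSpectrum A | FactorsAt A p F r n} := by
  rw [setOf_factorsAt_eq_range]
  apply PrimeSpectrum.isClosed_range_of_stableUnderSpecialization
  rw [← setOf_factorsAt_eq_range]
  intro p q hpq hp
  rw [← PrimeSpectrum.le_iff_specializes] at hpq
  obtain ⟨V, φ, hφ, hφq⟩ := exists_valuationSubring_comap_maximalIdeal (toResBar A p) q
    ((ker_toResBar p).trans_le hpq)
  have hfac : HasFactorization n (map V.subtype (map φ F)) := by
    rw [map_map, hφ]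
    exact hp
  have hne : map φ F ≠ 0 := by
    intro h0
    apply hF p
    rw [← hφ, ← map_map, h0, map_zero]
  have hres := hfac.residue V hne
  rw [map_map] at hres
  refine factorsAt_of_ker_eq _ q ?_ hres
  rw [← RingHom.comap_ker, IsLocalRing.ker_residue, hφq]

end Locus

section Irreducible

variable {ι σ K : Type*} [Field K]

theorem homogeneousComponent_mul_totalDegree {R : Type*} [CommRing R] (f g : MvPolynomial σ R) :
    homogeneousComponent (f.totalDegree + g.totalDegree) (f * g) =
      homogeneousComponent f.totalDegree f * homogeneousComponent g.totalDegree g := by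
  have hfg : f * g = ∑ i ∈ Finset.range (f.totalDegree + 1),
      ∑ j ∈ Finset.range (g.totalDegree + 1),
        homogeneousComponent i f * homogeneousComponent j g := by
    rw [← Finset.sum_mul_sum, sum_homogeneousComponent, sum_homogeneousComponent]
  rw [hfg, map_sum]
  simp_rw [map_sum]
  have key : ∀ i j, homogeneousComponent (f.totalDegree + g.totalDegree)
      (homogeneousComponent i f * homogeneousComponent j g) =
      if f.totalDegree + g.totalDegree = i + j then
        homogeneousComponent i f * homogeneousComponent j g else 0 := fun i j =>
    homogeneousComponent_of_mem ((homogeneousComponent_isHomogeneous i f).mul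
      (homogeneousComponent_isHomogeneous j g))
  simp_rw [key]
  rw [Finset.sum_eq_single f.totalDegree, Finset.sum_eq_single g.totalDegree]
  · simp
  · intro j hj hne
    rw [if_neg (by omega)]
  · simp
  · intro i hi hne
    refine Finset.sum_eq_zero fun j hj => ?_
    rw [Finset.mem_range] at hi hj
    rw [if_neg (by omega)]
  · simp

theorem totalDegree_pos_of_not_isUnit {f : MvPolynomial σ K} (hf : f ≠ 0) (hu : ¬ IsUnit f) :
    0 < f.totalDegree := by
  by_contra h
  have h0 := totalDegree_eq_zero_iff_eq_C.mp (Nat.eq_zero_of_not_pos h)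
  apply hu
  rw [h0]
  refine (IsUnit.mk0 _ fun hc => hf ?_).map C
  rw [h0, hc, C_0]

theorem _root_.MvPolynomial.IsHomogeneous.not_isUnit {f : MvPolynomial σ K} {n : ℕ}
    (hf : f.IsHomogeneous n) (hn : 0 < n) : ¬ IsUnit f := by
  intro hu
  have h0 := (isUnit_iff_totalDegree_of_isReduced.mp hu).2
  rw [hf.totalDegree hu.ne_zero] at h0
  omega

/-- A reducible homogeneous polynomial is a product of homogeneous polynomials of positive
degree. -/
theorem exists_mul_of_not_irreducible {f : MvPolynomial σ K} {n : ℕ} (hf : f.IsHomogeneous n)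
    (hn : 0 < n) (h0 : f ≠ 0) (hirr : ¬ Irreducible f) :
    ∃ (a b : ℕ) (g h : MvPolynomial σ K), 0 < a ∧ 0 < b ∧ a + b = n ∧
      g.IsHomogeneous a ∧ h.IsHomogeneous b ∧ f = g * h := by
  rw [irreducible_iff] at hirr
  push Not at hirr
  obtain ⟨g, h, rfl, hg, hh⟩ := hirr (hf.not_isUnit hn)
  have hg0 := left_ne_zero_of_mul h0
  have hh0 := right_ne_zero_of_mul h0
  have hdeg : g.totalDegree + h.totalDegree = n := by
    rw [← totalDegree_mul_of_isDomain hg0 hh0, hf.totalDegree h0]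
  refine ⟨g.totalDegree, h.totalDegree, _, _, totalDegree_pos_of_not_isUnit hg0 hg,
    totalDegree_pos_of_not_isUnit hh0 hh, hdeg, homogeneousComponent_isHomogeneous _ g,
    homogeneousComponent_isHomogeneous _ h, ?_⟩
  rw [← homogeneousComponent_mul_totalDegree, hdeg, homogeneousComponent_eq_self hf]

open UniqueFactorizationMonoid in
theorem card_factors_prod {M : Type*} [CommMonoidWithZero M] [UniqueFactorizationMonoid M]
    [Nontrivial M] (s : Finset ι) (f : ι → M) (hf : ∀ i ∈ s, f i ≠ 0) :
    (factors (∏ i ∈ s, f i)).card = ∑ i ∈ s, (factors (f i)).card := by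
  classical
  induction s using Finset.induction_on with
  | empty => simp
  | insert i s hi ih =>
    have hs : ∀ j ∈ s, f j ≠ 0 := fun j hj => hf j (Finset.mem_insert_of_mem hj)
    rw [Finset.prod_insert hi, Finset.sum_insert hi, ← ih hs, ← Multiset.card_add]
    exact Multiset.card_eq_card_of_rel
      (factors_mul (hf i (Finset.mem_insert_self i s)) (Finset.prod_ne_zero_iff.mpr hs))

open UniqueFactorizationMonoid in
/-- A product of irreducibles is not a product of a larger number of nonunits. -/
theorem card_le_of_prod_irreducible {M : Type*} [CommMonoidWithZero M]
    [UniqueFactorizationMonoid M] [Nontrivial M] {κ : Type*} [Fintype ι] [Fintype κ]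
    (f : ι → M) (g : κ → M) (hf : ∀ i, Irreducible (f i)) (hg : ∀ i, ¬ IsUnit (g i))
    (h : ∏ i, f i = ∏ i, g i) : Fintype.card κ ≤ Fintype.card ι := by
  have hf0 : ∏ i, f i ≠ 0 := Finset.prod_ne_zero_iff.mpr fun i _ => (hf i).ne_zero
  have hg0 : ∀ i, g i ≠ 0 := fun i => Finset.prod_ne_zero_iff.mp (h ▸ hf0) i (Finset.mem_univ i)
  have h1 := card_factors_prod Finset.univ f fun i _ => (hf i).ne_zero
  have h2 := card_factors_prod Finset.univ g fun i _ => hg0 i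
  simp_rw [card_factors_of_irreducible (hf _)] at h1
  have h3 : ∀ i ∈ Finset.univ, 1 ≤ (factors (g i)).card := fun i _ =>
    Multiset.card_pos.mpr fun h => hg i ((factors_eq_zero (hg0 i)).mp h)
  have h4 := Finset.sum_le_sum h3
  rw [← h2, ← h, h1] at h4
  simpa using h4

/-- A factorization into `r` homogeneous polynomials of positive degree can be chosen with
irreducible factors, or can be refined to one with `r + 1` factors of positive degree. -/
theorem exists_refinement {r : ℕ} {n : Fin r → ℕ} (hn : ∀ j, 0 < n j)
    (f : Fin r → MvPolynomial σ K) (hf : ∀ j, (f j).IsHomogeneous (n j)) (h0 : ∏ j, f j ≠ 0)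
    (hirr : ¬ ∀ j, Irreducible (f j)) :
    ∃ m : Fin (r + 1) → ℕ, (∀ j, 0 < m j) ∧ ∑ j, m j = ∑ j, n j ∧
      HasFactorization m (∏ j, f j) := by
  push Not at hirr
  obtain ⟨i, hi⟩ := hirr
  obtain ⟨a, b, g, h, ha, hb, hab, hg, hh, hgh⟩ := exists_mul_of_not_irreducible (hf i) (hn i)
    (Finset.prod_ne_zero_iff.mp h0 i (Finset.mem_univ i)) hi
  refine ⟨Fin.cons a (Function.update n i b), ?_, ?_, Fin.cons g (Function.update f i h), ?_, ?_⟩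
  · refine Fin.cases (by simpa) fun j => ?_
    rcases eq_or_ne j i with rfl | hj
    · simpa
    · simpa [hj] using hn j
  · rw [Fin.sum_univ_succ, Fin.cons_zero]
    simp_rw [Fin.cons_succ]
    rw [Finset.sum_update_of_mem (Finset.mem_univ i), ← add_assoc, hab,
      ← Finset.erase_eq, Finset.add_sum_erase _ _ (Finset.mem_univ i)]
  · refine Fin.cases (by simpa) fun j => ?_
    rcases eq_or_ne j i with rfl | hj
    · simpa
    · simpa [hj] using hf j
  · rw [Fin.prod_univ_succ, Fin.cons_zero]
    simp_rw [Fin.cons_succ]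
    rw [Finset.prod_update_of_mem (Finset.mem_univ i), ← mul_assoc, ← hgh,
      ← Finset.erase_eq, Finset.mul_prod_erase _ _ (Finset.mem_univ i)]

end Irreducible

theorem irredFactorsAt_iff {A : Type} [CommRing A] {p : PrimeSpectrum A}
    {F : MvPolynomial (Fin 3) A} {r : ℕ} {n : Fin r → ℕ} (hn : ∀ j, 0 < n j)
    (hF : map (toResBar A p) F ≠ 0) (hp : FactorsAt A p F r n) :
    IrredFactorsAt A p F r n ↔ ∀ m : Fin (r + 1) → ℕ, (∀ j, 0 < m j) →
      ∑ j, m j = ∑ j, n j → ¬ FactorsAt A p F (r + 1) m := by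
  constructor
  · rintro ⟨f, -, hirr, hprod⟩ m hm - ⟨g, hg, hprod'⟩
    have := card_le_of_prod_irreducible f g hirr (fun j => (hg j).not_isUnit (hm j))
      (hprod.symm.trans hprod')
    simp at this
  · intro h
    obtain ⟨f, hf, hprod⟩ := hp
    refine ⟨f, hf, ?_, hprod⟩
    by_contra hirr
    obtain ⟨m, hm, hsum, hfac⟩ := exists_refinement hn f hf (hprod ▸ hF) hirr
    rw [← hprod] at hfac
    exact h m hm hsum hfac

end HomogeneousFactorization

open HomogeneousFactorization

theorem statement_17 (A : Type) [CommRing A] [IsNoetherianRing A]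
    (d : ℕ) (hd : 1 ≤ d) (F : MvPolynomial (Fin 3) A) (hF : F.IsHomogeneous d)
    (hFnz : ∀ p : PrimeSpectrum A,
      MvPolynomial.map ((algebraMap (A ⧸ p.asIdeal) (resField A p)).comp
        (Ideal.Quotient.mk p.asIdeal)) F ≠ 0)
    (r : ℕ) (dd : Fin r → ℕ) (hdd : ∀ j, 0 < dd j) (hsum : ∑ j, dd j = d) :
    IsClosed {p : PrimeSpectrum A | FactorsAt A p F r dd} ∧
      IsOpen {q : {p : PrimeSpectrum A | FactorsAt A p F r dd} |
        IrredFactorsAt A q.val F r dd} := by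
  have hF0 := fun p => map_toResBar_ne_zero (hFnz p)
  have hr : Nonempty (Fin r) := by
    by_contra h
    rw [not_nonempty_iff] at h
    simp at hsum
    omega
  refine ⟨isClosed_setOf_factorsAt hF0, ?_⟩
  let M : Set (Fin (r + 1) → ℕ) := {m | (∀ j, 0 < m j) ∧ ∑ j, m j = ∑ j, dd j}
  have hM : M.Finite := by
    refine (Set.finite_Iic (fun _ : Fin (r + 1) => ∑ j, dd j)).subset fun m hm j => ?_
    rw [← hm.2]
    exact Finset.single_le_sum (fun _ _ => Nat.zero_le _) (Finset.mem_univ j)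
  have hclosed : IsClosed (⋃ m ∈ M, {p : PrimeSpectrum A | FactorsAt A p F (r + 1) m}) :=
    hM.isClosed_biUnion fun m _ => isClosed_setOf_factorsAt hF0
  convert! hclosed.isOpen_compl.preimage continuous_subtype_val using 1
  ext q
  simp [irredFactorsAt_iff hdd (hF0 q.1) q.2, M]

end
end
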